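/- The fixed subalgebra H^1_{R,r}(q) of the Goldman involution on the type A Iwahori-Hecke algebra is a free R-module of rank r!/2, i.e. rank_R H_{R,r}(q) = 2 · rank_R H^1_{R,r}(q). -/

import Mathlib

/-- Defining relations of the type A Iwahori-Hecke algebra with `n` generators. -/
inductive HeckeRel (R : Type*) [CommRing R] (q qi : R) (n : ℕ) :
    FreeAlgebra R (Fin n) → FreeAlgebra R (Fin n) → Prop
  | quad (i : Fin n) :
      HeckeRel R q qi n (FreeAlgebra.ι R i * FreeAlgebra.ι R i)
        (algebraMap R _ (q - qi) * FreeAlgebra.ι R i + 1)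
  | braid (i j : Fin n) (h : (j : ℕ) = (i : ℕ) + 1) :
      HeckeRel R q qi n (FreeAlgebra.ι R i * FreeAlgebra.ι R j * FreeAlgebra.ι R i)
        (FreeAlgebra.ι R j * FreeAlgebra.ι R i * FreeAlgebra.ι R j)
  | comm (i j : Fin n) (h : (i : ℕ) + 1 < (j : ℕ)) :
      HeckeRel R q qi n (FreeAlgebra.ι R i * FreeAlgebra.ι R j)
        (FreeAlgebra.ι R j * FreeAlgebra.ι R i)

/-- The type A Iwahori-Hecke algebra of rank `r - 1` (with `n = r - 1` generators). -/
abbrev Hecke (R : Type*) [CommRing R] (q qi : R) (n : ℕ) := RingQuot (HeckeRel R q qi n)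

/-- The standard generators `T_i`. -/
noncomputable def Tgen (R : Type*) [CommRing R] (q qi : R) (n : ℕ) (i : Fin n) :
    Hecke R q qi n :=
  RingQuot.mkAlgHom R (HeckeRel R q qi n) (FreeAlgebra.ι R i)

namespace HeckeFixed

section Permutation

variable {R α : Type*} [CommRing R] [LinearOrder α]

/-- The operator on `R[Perm α]` by which a Hecke generator with parameter `a` acts on the
positions `x` and `y`. -/
noncomputable def permOp (a : R) (x y : α) : Module.End R (Equiv.Perm α →₀ R) :=
  Finsupp.linearCombination R fun σ =>
    Finsupp.single (σ * Equiv.swap x y) 1 + if σ y < σ x then Finsupp.single σ a else 0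

theorem permOp_single (a : R) (x y : α) (σ : Equiv.Perm α) (b : R) :
    permOp a x y (Finsupp.single σ b) =
      Finsupp.single (σ * Equiv.swap x y) b +
        if σ y < σ x then a • Finsupp.single σ b else 0 := by
  rw [permOp, Finsupp.linearCombination_single, smul_add]
  split_ifs <;> simp [mul_comm]

theorem permOp_quad (a : R) {x y : α} (hxy : x ≠ y) :
    permOp a x y * permOp a x y = algebraMap R _ a * permOp a x y + 1 := by
  refine Finsupp.lhom_ext fun σ b => ?_
  have hne : σ x ≠ σ y := fun h => hxy (σ.injective h)
  rcases lt_or_gt_of_ne hne with h | h <;>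
  simp only [permOp_single, Module.End.mul_apply, LinearMap.add_apply, LinearMap.smul_apply,
    Module.End.one_apply, Equiv.Perm.mul_apply, Equiv.swap_apply_left, Equiv.swap_apply_right,
    map_add, map_smul, h, h.not_gt, if_true, if_false, mul_assoc, Equiv.swap_mul_self, mul_one,
    Algebra.algebraMap_eq_smul_one, add_zero] <;> module

theorem permOp_comm (a : R) {x y z w : α} (hxz : x ≠ z) (hxw : x ≠ w) (hyz : y ≠ z)
    (hyw : y ≠ w) :
    permOp a x y * permOp a z w = permOp a z w * permOp a x y := by
  refine Finsupp.lhom_ext fun σ b => ?_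
  have hs : Equiv.swap x y * Equiv.swap z w = Equiv.swap z w * Equiv.swap x y := by
    have := Equiv.Perm.Disjoint.commute (f := Equiv.swap x y) (g := Equiv.swap z w) (by
      intro t
      by_cases h1 : t = x
      · right; subst h1; exact Equiv.swap_apply_of_ne_of_ne hxz hxw
      · by_cases h2 : t = y
        · right; subst h2; exact Equiv.swap_apply_of_ne_of_ne hyz hyw
        · left; exact Equiv.swap_apply_of_ne_of_ne h1 h2)
    exact this
  have e1 : Equiv.swap x y z = z := Equiv.swap_apply_of_ne_of_ne hxz.symm hyz.symm
  have e2 : Equiv.swap x y w = w := Equiv.swap_apply_of_ne_of_ne hxw.symm hyw.symm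
  have e3 : Equiv.swap z w x = x := Equiv.swap_apply_of_ne_of_ne hxz hxw
  have e4 : Equiv.swap z w y = y := Equiv.swap_apply_of_ne_of_ne hyz hyw
  simp only [Module.End.mul_apply, permOp_single, map_add, apply_ite (permOp a _ _),
    map_zero, Equiv.Perm.mul_apply, e1, e2, e3, e4, mul_assoc, hs]
  split_ifs <;> simp only [map_smul, permOp_single, *, if_true, if_false] <;> module

theorem permOp_braid (a : R) {x y z : α} (hxy : x ≠ y) (hyz : y ≠ z) (hxz : x ≠ z) :
    permOp a x y * permOp a y z * permOp a x y = permOp a y z * permOp a x y * permOp a y z := by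
  refine Finsupp.lhom_ext fun σ b => ?_
  have hs : Equiv.swap x y * (Equiv.swap y z * Equiv.swap x y) =
      Equiv.swap y z * (Equiv.swap x y * Equiv.swap y z) := by
    ext t
    simp only [Equiv.Perm.mul_apply, Equiv.swap_apply_def]
    split_ifs <;> simp_all
  have e1 : Equiv.swap x y z = z := Equiv.swap_apply_of_ne_of_ne hxz.symm hyz.symm
  have e2 : Equiv.swap y z x = x := Equiv.swap_apply_of_ne_of_ne hxy hxz
  have n1 : σ x ≠ σ y := fun h => hxy (σ.injective h)
  have n2 : σ y ≠ σ z := fun h => hyz (σ.injective h)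
  have n3 : σ x ≠ σ z := fun h => hxz (σ.injective h)
  rcases lt_or_gt_of_ne n1 with h1 | h1 <;> rcases lt_or_gt_of_ne n2 with h2 | h2 <;>
  rcases lt_or_gt_of_ne n3 with h3 | h3 <;>
  first
  | exact absurd (h1.trans h2) h3.not_gt
  | exact absurd (h2.trans h1) h3.not_gt
  | (simp only [permOp_single, Module.End.mul_apply, Equiv.Perm.mul_apply, map_add, map_smul,
      Equiv.swap_apply_left, Equiv.swap_apply_right, e1, e2, h1, h2, h3, h1.not_gt, h2.not_gt,
      h3.not_gt, if_true, if_false, mul_assoc, hs, Equiv.swap_mul_self, mul_one, add_zero] <;>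
     module)

end Permutation

section Representation

variable {R : Type*} [CommRing R]

/-- The regular representation of the Hecke algebra on `R[Perm (Fin (n + 1))]`. -/
noncomputable def permRep (q qi : R) (n : ℕ) :
    Hecke R q qi n →ₐ[R] Module.End R (Equiv.Perm (Fin (n + 1)) →₀ R) :=
  RingQuot.liftAlgHom R
    ⟨FreeAlgebra.lift R fun i : Fin n => permOp (q - qi) i.castSucc i.succ, by
      intro x y hxy
      induction hxy with
      | quad i =>
        simpa using permOp_quad (q - qi) (Fin.castSucc_lt_succ (i := i)).ne
      | braid i j h =>
        have hj : j.castSucc = i.succ := by ext; simpa using h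
        have h1 : i.castSucc ≠ i.succ := (Fin.castSucc_lt_succ (i := i)).ne
        have h2 : i.succ ≠ j.succ := by
          rw [← hj]; exact (Fin.castSucc_lt_succ (i := j)).ne
        have h3 : i.castSucc ≠ j.succ := by
          intro h'; have := congrArg Fin.val h'; simp at this; omega
        simpa [hj] using permOp_braid (q - qi) h1 h2 h3
      | comm i j h =>
        simp only [map_mul, FreeAlgebra.lift_ι_apply]
        apply permOp_comm <;> intro h' <;> have := congrArg Fin.val h' <;> simp at this <;> omega⟩

theorem permRep_Tgen (q qi : R) (n : ℕ) (i : Fin n) :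
    permRep q qi n (Tgen R q qi n i) = permOp (q - qi) i.castSucc i.succ := by
  simp [permRep, Tgen]

/-- The orbit map of the identity permutation. -/
noncomputable def orbitMap (q qi : R) (n : ℕ) :
    Hecke R q qi n →ₗ[R] (Equiv.Perm (Fin (n + 1)) →₀ R) :=
  (LinearMap.applyₗ (Finsupp.single 1 1)).comp (permRep q qi n).toLinearMap

theorem orbitMap_surjective (q qi : R) (n : ℕ) : Function.Surjective (orbitMap q qi n) := by
  have key : ∀ σ : Equiv.Perm (Fin (n + 1)),
      Finsupp.single σ (1 : R) ∈ LinearMap.range (orbitMap q qi n) := by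
    intro σ
    have hσ : σ ∈ Submonoid.closure
        (Set.range fun i : Fin n => Equiv.swap i.castSucc i.succ) := by
      rw [Equiv.Perm.mclosure_swap_castSucc_succ]; trivial
    induction hσ using Submonoid.closure_induction_right with
    | one => exact ⟨1, by simp [orbitMap]⟩
    | mul_right σ _ s hs ih =>
      obtain ⟨i, rfl⟩ := hs
      obtain ⟨x, hx⟩ := ih
      have h1 : permOp (q - qi) i.castSucc i.succ (Finsupp.single σ 1) ∈
          LinearMap.range (orbitMap q qi n) := by
        refine ⟨Tgen R q qi n i * x, ?_⟩
        rw [← hx]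
        simp [orbitMap, permRep_Tgen]
      have h2 := Submodule.smul_mem _
        (if σ i.succ < σ i.castSucc then q - qi else 0) (LinearMap.mem_range_self (orbitMap q qi n) x)
      rw [hx] at h2
      have h3 := Submodule.sub_mem _ h1 h2
      rw [permOp_single] at h3
      convert h3 using 1
      split_ifs <;> simp
  rw [← LinearMap.range_eq_top, eq_top_iff]
  intro f _
  induction f using Finsupp.induction_linear with
  | zero => exact Submodule.zero_mem _
  | add f g hf hg => exact Submodule.add_mem _ (hf trivial) (hg trivial)
  | single σ b =>
    have := Submodule.smul_mem _ b (key σ)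
    rwa [Finsupp.smul_single, smul_eq_mul, mul_one] at this

end Representation

section Words

/-- The words `k-1, k-2, …, j` for `j ≤ k`. -/
def cosetWords : ℕ → List (List ℕ)
  | 0 => [[]]
  | k + 1 => [] :: (cosetWords k).map (k :: ·)

/-- Normal forms for words in the generators `0, …, k-1`. -/
def normalWords : ℕ → List (List ℕ)
  | 0 => [[]]
  | k + 1 => (normalWords k).flatMap fun u => (cosetWords (k + 1)).map (u ++ ·)

theorem length_cosetWords (k : ℕ) : (cosetWords k).length = k + 1 := by
  induction k with
  | zero => rfl
  | succ k ih => simp [cosetWords, ih]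

theorem length_normalWords (k : ℕ) : (normalWords k).length = (k + 1).factorial := by
  induction k with
  | zero => rfl
  | succ k ih =>
    simp [normalWords, length_cosetWords, List.length_flatMap, ih, Nat.factorial_succ (k + 1)]
    ring

theorem lt_of_mem_cosetWords {k : ℕ} : ∀ u ∈ cosetWords k, ∀ i ∈ u, i < k := by
  induction k with
  | zero => simp [cosetWords]
  | succ k ih =>
    intro u hu i hi
    simp only [cosetWords, List.mem_cons, List.mem_map] at hu
    rcases hu with rfl | ⟨v, hv, rfl⟩
    · simp at hi
    · rcases List.mem_cons.1 hi with rfl | hi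
      · omega
      · have := ih v hv i hi; omega

theorem lt_of_mem_normalWords {k : ℕ} : ∀ u ∈ normalWords k, ∀ i ∈ u, i < k := by
  induction k with
  | zero => simp [normalWords]
  | succ k ih =>
    intro u hu i hi
    simp only [normalWords, List.mem_flatMap, List.mem_map] at hu
    obtain ⟨v, hv, w, hw, rfl⟩ := hu
    rcases List.mem_append.1 hi with hi | hi
    · have := ih v hv i hi; omega
    · exact lt_of_mem_cosetWords w hw i hi

/-- The sum of `(-1) ^ length` over a list of words. -/
def signSum (L : List (List ℕ)) : ℤ := (L.map fun u => (-1 : ℤ) ^ u.length).sum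

theorem signSum_normalWords (k : ℕ) : signSum (normalWords (k + 1)) = 0 := by
  have mul : ∀ A B : List (List ℕ),
      signSum (A.flatMap fun u => B.map (u ++ ·)) = signSum A * signSum B := by
    intro A B
    induction A with
    | nil => simp [signSum]
    | cons u A ih =>
      simp only [signSum, List.flatMap_cons, List.map_append, List.sum_append, List.map_map,
        List.map_cons, List.sum_cons, add_mul] at ih ⊢
      rw [ih]
      simp only [Function.comp_def, List.length_append, pow_add, List.sum_map_mul_left]
  induction k with
  | zero => rfl
  | succ k ih => rw [normalWords, mul, ih, zero_mul]

end Words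

section Span

variable {R A : Type*} [CommRing R] [Ring A] [Algebra R A]

/-- The span of the monomials in `g` given by a list of words. -/
def wordSpan (R : Type*) {A : Type*} [CommRing R] [Ring A] [Algebra R A] (g : ℕ → A)
    (L : List (List ℕ)) : Submodule R A :=
  Submodule.span R {x | ∃ u ∈ L, (u.map g).prod = x}

theorem wordSpan_cosetWords_succ (g : ℕ → A) (k : ℕ) :
    wordSpan R g (cosetWords (k + 1)) = 1 ⊔ Submodule.span R {g k} * wordSpan R g (cosetWords k) := by
  rw [wordSpan, wordSpan, Submodule.span_mul_span, Submodule.one_eq_span, ← Submodule.span_union]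
  congr 1
  ext x
  simp only [cosetWords, Set.mem_ofPred_eq, List.mem_cons, List.mem_map, Set.mem_union,
    Set.mem_singleton_iff, Set.singleton_mul, Set.mem_image]
  constructor
  · rintro ⟨u, rfl | ⟨v, hv, rfl⟩, rfl⟩
    · left; simp
    · right; exact ⟨_, ⟨v, hv, rfl⟩, by simp⟩
  · rintro (rfl | ⟨_, ⟨v, hv, rfl⟩, rfl⟩)
    · exact ⟨[], by simp, by simp⟩
    · exact ⟨k :: v, Or.inr ⟨v, hv, rfl⟩, by simp⟩

theorem wordSpan_normalWords_succ (g : ℕ → A) (k : ℕ) :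
    wordSpan R g (normalWords (k + 1)) =
      wordSpan R g (normalWords k) * wordSpan R g (cosetWords (k + 1)) := by
  rw [wordSpan, wordSpan, wordSpan, Submodule.span_mul_span]
  congr 1
  ext x
  simp only [normalWords, Set.mem_ofPred_eq, List.mem_flatMap, List.mem_map, Set.mem_mul]
  constructor
  · rintro ⟨_, ⟨u, hu, v, hv, rfl⟩, rfl⟩
    exact ⟨_, ⟨u, hu, rfl⟩, _, ⟨v, hv, rfl⟩, by simp⟩
  · rintro ⟨_, ⟨u, hu, rfl⟩, _, ⟨v, hv, rfl⟩, rfl⟩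
    exact ⟨_, ⟨u, hu, v, hv, rfl⟩, by simp⟩

theorem wordSpan_zero (g : ℕ → A) : wordSpan R g [[]] = 1 := by
  simp [wordSpan, Submodule.one_eq_span]

theorem span_commute_wordSpan (g : ℕ → A) {k j : ℕ} (hg : ∀ i < j, Commute (g k) (g i)) :
    Commute (Submodule.span R {g k}) (wordSpan R g (normalWords j)) := by
  rw [Commute, SemiconjBy, wordSpan, Submodule.span_mul_span, Submodule.span_mul_span]
  congr 1
  simp only [Set.singleton_mul, Set.mul_singleton]
  refine Set.image_congr ?_
  rintro _ ⟨u, hu, rfl⟩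
  refine Commute.list_prod_right _ _ fun x hx => ?_
  obtain ⟨i, hi, rfl⟩ := List.mem_map.1 hx
  exact hg i (lt_of_mem_normalWords u hu i hi)

theorem wordSpan_normalWords_mul_self (g : ℕ → A) (n : ℕ)
    (hsq : ∀ i < n, g i * g i = 1)
    (hcomm : ∀ i j, i + 1 < j → j < n → Commute (g j) (g i))
    (hbraid : ∀ i, i + 1 < n → ∃ κ : R,
      g (i + 1) * g i * g (i + 1) = g i * g (i + 1) * g i + κ • (g (i + 1) - g i))
    (k : ℕ) (hk : k ≤ n) :
    wordSpan R g (normalWords k) * wordSpan R g (normalWords k) ≤ wordSpan R g (normalWords k) ∧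
    (∀ i < k, g i ∈ wordSpan R g (normalWords k)) := by
  set P : ℕ → Submodule R A := fun k => wordSpan R g (normalWords k) with hP
  set D : ℕ → Submodule R A := fun k => wordSpan R g (cosetWords k) with hD
  set G : ℕ → Submodule R A := fun k => Submodule.span R {g k} with hG
  have hP0 : P 0 = 1 := wordSpan_zero g
  have hD0 : D 0 = 1 := wordSpan_zero g
  have hDs : ∀ k, D (k + 1) = 1 ⊔ G k * D k := wordSpan_cosetWords_succ g
  have hPs : ∀ k, P (k + 1) = P k * D (k + 1) := wordSpan_normalWords_succ g
  have h1D : ∀ k, 1 ≤ D k := fun k => by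
    cases k with
    | zero => exact hD0.ge
    | succ k => rw [hDs]; exact le_sup_left
  have hPmono : ∀ k, P k ≤ P (k + 1) := fun k => by
    rw [hPs]; exact le_mul_of_one_le_right' (h1D _)
  have h1P : ∀ k, 1 ≤ P k := fun k => by
    induction k with
    | zero => exact hP0.ge
    | succ k ih => exact ih.trans (hPmono k)
  have hGP : ∀ k, k + 1 < n → G (k + 1) * P k = P k * G (k + 1) := fun k hk =>
    span_commute_wordSpan g fun i hi => hcomm i (k + 1) (by omega) hk
  have hGG : ∀ k < n, G k * G k = 1 := fun k hk => by
    simp [hG, Submodule.span_mul_span, hsq k hk, Submodule.one_eq_span]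
  have hbr : ∀ k, k + 1 < n →
      G (k + 1) * G k * G (k + 1) ≤ G k * G (k + 1) * G k ⊔ (G (k + 1) ⊔ G k) := by
    intro k hk
    obtain ⟨κ, h⟩ := hbraid k hk
    simp only [hG, Submodule.span_mul_span, Set.singleton_mul_singleton]
    rw [Submodule.span_le, Set.singleton_subset_iff, h]
    refine Submodule.add_mem_sup (Submodule.mem_span_singleton_self _)
      (Submodule.smul_mem _ _ (Submodule.sub_mem _ ?_ ?_))
    · exact Submodule.mem_sup_left (Submodule.mem_span_singleton_self _)
    · exact Submodule.mem_sup_right (Submodule.mem_span_singleton_self _)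
  have main : ∀ k, k ≤ n → P k * P k = P k ∧
      (k < n → P (k + 1) = P k ⊔ P k * G k * P k ∧ G k * P k * G k ≤ P (k + 1)) := by
    intro k
    induction k with
    | zero =>
      intro _
      refine ⟨by rw [hP0, one_mul], fun h => ?_⟩
      refine ⟨by rw [hPs, hDs, hP0, hD0]; simp, ?_⟩
      rw [hP0, mul_one, hGG 0 h]
      exact h1P 1
    | succ k ih =>
      intro hk
      obtain ⟨ih1, ih2⟩ := ih (by omega)
      obtain ⟨ih3, ih4⟩ := ih2 (by omega)
      have hGle : G k ≤ P (k + 1) := by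
        rw [ih3]
        refine le_trans ?_ le_sup_right
        calc G k = 1 * G k * 1 := by simp
          _ ≤ P k * G k * P k := mul_le_mul' (mul_le_mul' (h1P k) le_rfl) (h1P k)
      have absorb : P (k + 1) * P k = P (k + 1) := by
        rw [ih3, Submodule.sup_mul, ih1, mul_assoc _ (P k) (P k), ih1]
      have absorb' : P k * P (k + 1) = P (k + 1) := by
        rw [ih3, Submodule.mul_sup, ih1, ← mul_assoc (P k), ← mul_assoc (P k), ih1]
      have closed : P (k + 1) * P (k + 1) = P (k + 1) := by
        refine le_antisymm ?_ (le_mul_of_one_le_right' (h1P _))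
        conv_lhs => rw [ih3]
        rw [Submodule.sup_mul, Submodule.mul_sup, Submodule.mul_sup]
        have e0 : P k * (P k * G k * P k) ≤ P (k + 1) := by
          rw [← mul_assoc, ← mul_assoc, ih1, ih3]; exact le_sup_right
        have e1 : P k * G k * P k * P k ≤ P (k + 1) := by
          rw [mul_assoc _ (P k), ih1, ih3]; exact le_sup_right
        have e2 : P k * G k * P k * (P k * G k * P k) ≤ P (k + 1) := by
          calc P k * G k * P k * (P k * G k * P k)
              = P k * (G k * (P k * P k) * G k) * P k := by simp only [mul_assoc]
            _ = P k * (G k * P k * G k) * P k := by rw [ih1]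
            _ ≤ P k * P (k + 1) * P k := mul_le_mul' (mul_le_mul' le_rfl ih4) le_rfl
            _ = P (k + 1) := by rw [absorb', absorb]
        rw [ih1]
        exact sup_le (sup_le (hPmono k) e0) (sup_le e1 e2)
      refine ⟨closed, fun hk' => ?_⟩
      have form : P (k + 1 + 1) = P (k + 1) ⊔ P (k + 1) * G (k + 1) * P (k + 1) := by
        rw [hPs (k + 1), hDs (k + 1), Submodule.mul_sup, mul_one]
        congr 1
        conv_rhs => rw [hPs k, mul_assoc, ← mul_assoc (G (k + 1)), hGP k hk', ← hPs k]
        rw [← mul_assoc, ← mul_assoc, ← mul_assoc, absorb]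
      refine ⟨form, ?_⟩
      have sub1 : P (k + 1) ≤ P (k + 1 + 1) := hPmono _
      have sub2 : P (k + 1) * G (k + 1) * P (k + 1) ≤ P (k + 1 + 1) := by
        rw [form]; exact le_sup_right
      conv_lhs => rw [ih3]
      rw [Submodule.mul_sup, Submodule.sup_mul]
      refine sup_le ?_ ?_
      · rw [hGP k hk', mul_assoc, hGG _ hk', mul_one]
        exact (hPmono k).trans sub1
      · calc G (k + 1) * (P k * G k * P k) * G (k + 1)
            = (G (k + 1) * P k) * G k * (P k * G (k + 1)) := by simp only [mul_assoc]
          _ = P k * (G (k + 1) * G k * G (k + 1)) * P k := by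
            have e : G (k + 1) * P k * G k * (P k * G (k + 1)) =
                P k * G (k + 1) * G k * (G (k + 1) * P k) := by rw [hGP k hk']
            rw [e]
            simp only [mul_assoc]
          _ ≤ P k * (G k * G (k + 1) * G k ⊔ (G (k + 1) ⊔ G k)) * P k :=
            mul_le_mul' (mul_le_mul' le_rfl (hbr k hk')) le_rfl
          _ ≤ P (k + 1) * (P (k + 1) * G (k + 1) * P (k + 1) ⊔ P (k + 1)) * P (k + 1) := by
            refine mul_le_mul' (mul_le_mul' (hPmono k) ?_) (hPmono k)
            refine sup_le ?_ (sup_le ?_ (hGle.trans le_sup_right))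
            · exact (mul_le_mul' (mul_le_mul' hGle le_rfl) hGle).trans le_sup_left
            · refine le_trans ?_ le_sup_left
              calc G (k + 1) = 1 * G (k + 1) * 1 := by simp
                _ ≤ _ := mul_le_mul' (mul_le_mul' (h1P _) le_rfl) (h1P _)
          _ ≤ P (k + 1 + 1) := by
            rw [Submodule.mul_sup, Submodule.sup_mul, closed, closed, ← mul_assoc, ← mul_assoc,
              closed, mul_assoc _ (P (k + 1)), closed]
            exact sup_le sub2 sub1
  refine ⟨(main k hk).1.le, ?_⟩
  change ∀ i < k, g i ∈ P k
  induction k with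
  | zero => simp
  | succ k ih =>
    intro i hi
    rcases Nat.lt_succ_iff_lt_or_eq.1 hi with hi | rfl
    · exact hPmono k (ih (by omega) i hi)
    · have h := ((main i (by omega)).2 (by omega)).1
      have hle : G i ≤ P (i + 1) := by
        rw [h]
        refine le_trans ?_ le_sup_right
        calc G i = 1 * G i * 1 := by simp
          _ ≤ P i * G i * P i := mul_le_mul' (mul_le_mul' (h1P i) le_rfl) (h1P i)
      exact hle (Submodule.mem_span_singleton_self _)

end Span

section Generators

variable {R : Type*} [CommRing R]

theorem Tgen_mul_self (q qi : R) {n : ℕ} (i : Fin n) :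
    Tgen R q qi n i * Tgen R q qi n i = (q - qi) • Tgen R q qi n i + 1 := by
  simpa [Tgen, Algebra.algebraMap_eq_smul_one] using
    RingQuot.mkAlgHom_rel R (HeckeRel.quad (R := R) (q := q) (qi := qi) i)

theorem Tgen_braid (q qi : R) {n : ℕ} {i j : Fin n} (h : (j : ℕ) = i + 1) :
    Tgen R q qi n i * Tgen R q qi n j * Tgen R q qi n i =
      Tgen R q qi n j * Tgen R q qi n i * Tgen R q qi n j := by
  simpa [Tgen] using
    RingQuot.mkAlgHom_rel R (HeckeRel.braid (R := R) (q := q) (qi := qi) i j h)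

theorem Tgen_commute (q qi : R) {n : ℕ} {i j : Fin n} (h : (i : ℕ) + 1 < j) :
    Commute (Tgen R q qi n i) (Tgen R q qi n j) := by
  simpa [Tgen, Commute, SemiconjBy] using
    RingQuot.mkAlgHom_rel R (HeckeRel.comm (R := R) (q := q) (qi := qi) i j h)

theorem adjoin_range_Tgen (q qi : R) (n : ℕ) :
    Algebra.adjoin R (Set.range (Tgen R q qi n)) = ⊤ := by
  have h := congrArg (Subalgebra.map (RingQuot.mkAlgHom R (HeckeRel R q qi n)))
    (FreeAlgebra.adjoin_range_ι R (Fin n))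
  rw [AlgHom.map_adjoin, ← Set.range_comp, Algebra.map_top,
    (AlgHom.range_eq_top _).2 (RingQuot.mkAlgHom_surjective R _)] at h
  exact h

/-- The normalised generators `c (2 T_i - (q - q⁻¹))`, which square to one and are negated by the
Goldman involution. -/
noncomputable def symGen (q qi c : R) (n i : ℕ) : Hecke R q qi n :=
  if h : i < n then c • ((2 : R) • Tgen R q qi n ⟨i, h⟩ - (q - qi) • 1) else 0

theorem symGen_mul_self {q qi c : R} (hq : q * qi = 1) (hc : (q + qi) * c = 1) {n i : ℕ}
    (hi : i < n) : symGen q qi c n i * symGen q qi c n i = 1 := by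
  have h := Tgen_mul_self q qi (⟨i, hi⟩ : Fin n)
  simp only [symGen, hi, dif_pos]
  generalize Tgen R q qi n ⟨i, hi⟩ = t at h
  have e : c ^ 2 * (4 + (q - qi) ^ 2) = 1 := by
    linear_combination (-4 * c ^ 2) * hq + ((q + qi) * c + 1) * hc
  simp only [smul_mul_assoc, mul_smul_comm, mul_sub, sub_mul, mul_one, one_mul, h]
  calc _ = (c ^ 2 * (4 + (q - qi) ^ 2)) • (1 : Hecke R q qi n) := by module
    _ = 1 := by rw [e, one_smul]

theorem symGen_commute (q qi c : R) {n i j : ℕ} (hij : i + 1 < j) (hj : j < n) :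
    Commute (symGen q qi c n j) (symGen q qi c n i) := by
  have hi : i < n := by omega
  have h := (Tgen_commute q qi (i := (⟨i, hi⟩ : Fin n)) (j := ⟨j, hj⟩) hij).symm
  simp only [symGen, hi, hj, dif_pos]
  refine ((Commute.sub_left ?_ ?_).smul_left c).smul_right c
  · exact ((h.smul_right _).sub_right ((Commute.one_right _).smul_right _)).smul_left _
  · exact (Commute.one_left _).smul_left _

theorem symGen_braid (q qi c : R) {n i : ℕ} (hi : i + 1 < n) :
    symGen q qi c n (i + 1) * symGen q qi c n i * symGen q qi c n (i + 1) =
      symGen q qi c n i * symGen q qi c n (i + 1) * symGen q qi c n i +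
        (-(q - qi) ^ 2 * c ^ 2) • (symGen q qi c n (i + 1) - symGen q qi c n i) := by
  have hi' : i < n := by omega
  have h := Tgen_braid q qi (i := (⟨i, hi'⟩ : Fin n)) (j := ⟨i + 1, hi⟩) rfl
  have h1 := Tgen_mul_self q qi (⟨i, hi'⟩ : Fin n)
  have h2 := Tgen_mul_self q qi (⟨i + 1, hi⟩ : Fin n)
  simp only [symGen, hi, hi', dif_pos]
  generalize Tgen R q qi n ⟨i, hi'⟩ = s at *
  generalize Tgen R q qi n ⟨i + 1, hi⟩ = t at *
  simp only [smul_mul_assoc, mul_smul_comm, mul_sub, sub_mul, mul_one, one_mul, h1, h2, ← h,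
    smul_sub]
  module

theorem wordSpan_symGen {q qi c h : R} (hq : q * qi = 1) (hc : (q + qi) * c = 1)
    (h2 : (2 : R) * h = 1) (n : ℕ) :
    wordSpan R (symGen q qi c n) (normalWords n) = ⊤ := by
  obtain ⟨hmul, hmem⟩ := wordSpan_normalWords_mul_self (R := R) (symGen q qi c n) n
    (fun i hi => symGen_mul_self hq hc hi) (fun i j hij hj => symGen_commute q qi c hij hj)
    (fun i hi => ⟨_, symGen_braid q qi c hi⟩) n le_rfl
  have hone : ∀ k, (1 : Hecke R q qi n) ∈ wordSpan R (symGen q qi c n) (normalWords k) := by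
    intro k
    refine Submodule.subset_span ⟨[], ?_, by simp⟩
    induction k with
    | zero => simp [normalWords]
    | succ k ih => exact List.mem_flatMap.2 ⟨[], ih, by simp [cosetWords]⟩
  let S : Subalgebra R (Hecke R q qi n) :=
    (wordSpan R (symGen q qi c n) (normalWords n)).toSubalgebra (hone n)
      fun x y hx hy => hmul (Submodule.mul_mem_mul hx hy)
  have hS : S = ⊤ := by
    rw [eq_top_iff, ← adjoin_range_Tgen, Algebra.adjoin_le_iff]
    rintro _ ⟨i, rfl⟩
    change Tgen R q qi n i ∈ wordSpan R (symGen q qi c n) (normalWords n)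
    have e : Tgen R q qi n i =
        h • ((q + qi) • symGen q qi c n i + (q - qi) • 1) := by
      simp only [symGen, i.isLt, dif_pos, Fin.eta]
      rw [smul_smul, hc, one_smul, sub_add_cancel, smul_smul, mul_comm, h2, one_smul]
    rw [e]
    exact Submodule.smul_mem _ _ (Submodule.add_mem _ (Submodule.smul_mem _ _ (hmem i i.isLt))
      (Submodule.smul_mem _ _ (hone n)))
  rw [eq_top_iff]
  intro x _
  have : x ∈ S := hS ▸ Algebra.mem_top
  exact this

/-- The monomials in the normalised generators indexed by the normal words. -/
noncomputable def symMonomial (q qi c : R) (n : ℕ) (i : Fin (normalWords n).length) :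
    Hecke R q qi n :=
  (((normalWords n).get i).map (symGen q qi c n)).prod

theorem span_range_symMonomial {q qi c h : R} (hq : q * qi = 1) (hc : (q + qi) * c = 1)
    (h2 : (2 : R) * h = 1) (n : ℕ) :
    Submodule.span R (Set.range (symMonomial q qi c n)) = ⊤ := by
  rw [← wordSpan_symGen hq hc h2 n, wordSpan]
  congr 1
  ext x
  simp [symMonomial, List.mem_iff_get]

theorem linearIndependent_symMonomial [Nontrivial R] {q qi c h : R} (hq : q * qi = 1)
    (hc : (q + qi) * c = 1) (h2 : (2 : R) * h = 1) (n : ℕ) :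
    LinearIndependent R (symMonomial q qi c n) := by
  have hcard : Fintype.card (Equiv.Perm (Fin (n + 1))) =
      Fintype.card (Fin (normalWords n).length) := by
    rw [Fintype.card_perm, Fintype.card_fin, Fintype.card_fin, length_normalWords]
  let e := Finsupp.domLCongr (M := R) (R := R) (Fintype.equivOfCardEq hcard)
  have hsurj : Function.Surjective (Finsupp.linearCombination R (symMonomial q qi c n)) := by
    rw [← LinearMap.range_eq_top, Finsupp.range_linearCombination,
      span_range_symMonomial hq hc h2]
  have hinj := OrzechProperty.injective_of_surjective_endomorphism
    (e.toLinearMap ∘ₗ orbitMap q qi n ∘ₗ Finsupp.linearCombination R (symMonomial q qi c n))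
    (e.surjective.comp ((orbitMap_surjective q qi n).comp hsurj))
  rw [LinearMap.coe_comp, LinearMap.coe_comp, ← Function.comp_assoc] at hinj
  exact hinj.of_comp

theorem map_symMonomial {q qi c : R} {n : ℕ} (hat : Hecke R q qi n →ₐ[R] Hecke R q qi n)
    (hhat : ∀ i, hat (Tgen R q qi n i) = algebraMap R _ (q - qi) - Tgen R q qi n i)
    (i : Fin (normalWords n).length) :
    hat (symMonomial q qi c n i) =
      (-1 : R) ^ ((normalWords n).get i).length • symMonomial q qi c n i := by
  have hgen : ∀ k, hat (symGen q qi c n k) = (-1 : R) • symGen q qi c n k := by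
    intro k
    unfold symGen
    split_ifs with hk
    · simp only [map_smul, map_sub, map_one, hhat, Algebra.algebraMap_eq_smul_one]
      module
    · simp
  rw [symMonomial]
  generalize (normalWords n).get i = u
  induction u with
  | nil => simp
  | cons k u ih =>
    rw [List.map_cons, List.prod_cons, map_mul, hgen, ih, List.length_cons, pow_succ',
      smul_mul_smul_comm]

end Generators

section Eigenspace

variable {R M ι : Type*} [CommRing R] [AddCommGroup M] [Module R M]

/-- The fixed space of an endomorphism that acts on a basis by signs is spanned by the basis
vectors of sign one. -/
theorem ker_sub_id_eq_span {h : R} (h2 : (2 : R) * h = 1) (b : Module.Basis ι R M)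
    (f : M →ₗ[R] M) (s : ι → ℕ) (hf : ∀ i, f (b i) = (-1 : R) ^ s i • b i) :
    LinearMap.ker (f - LinearMap.id) =
      Submodule.span R (Set.range fun i : {i // Even (s i)} => b i) := by
  apply le_antisymm
  · intro x hx
    have hx' : f x = x := by simpa [sub_eq_zero] using hx
    have hcoord : ∀ y i, b.repr (f y) i = (-1 : R) ^ s i * b.repr y i := by
      intro y i
      have : (Finsupp.lapply i ∘ₗ b.repr.toLinearMap ∘ₗ f) =
          (-1 : R) ^ s i • (Finsupp.lapply i ∘ₗ b.repr.toLinearMap) := by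
        refine b.ext fun j => ?_
        by_cases hij : j = i
        · subst hij; simp [hf]
        · simp [hf, hij]
      simpa using LinearMap.congr_fun this y
    rw [← b.linearCombination_repr x, Finsupp.linearCombination_apply, Finsupp.sum]
    refine Submodule.sum_mem _ fun i hi => Submodule.smul_mem _ _ ?_
    refine Submodule.subset_span ⟨⟨i, ?_⟩, rfl⟩
    by_contra hodd
    have h3 := hcoord x i
    rw [hx', (Nat.not_even_iff_odd.1 hodd).neg_one_pow] at h3
    exact Finsupp.mem_support_iff.1 hi
      (by linear_combination h * h3 - b.repr x i * h2)
  · rw [Submodule.span_le]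
    rintro _ ⟨⟨i, hi⟩, rfl⟩
    simp [hf, hi.neg_one_pow]

theorem two_mul_card_even {ι : Type*} [Fintype ι] (s : ι → ℕ)
    (hs : ∑ i, (-1 : ℤ) ^ s i = 0) :
    2 * Fintype.card {i // Even (s i)} = Fintype.card ι := by
  classical
  have h : ∀ i, (-1 : ℤ) ^ s i = 2 * (if Even (s i) then 1 else 0) - 1 := by
    intro i
    split_ifs with hi
    · rw [hi.neg_one_pow]; norm_num
    · rw [(Nat.not_even_iff_odd.1 hi).neg_one_pow]; norm_num
  simp only [h, Finset.sum_sub_distrib, ← Finset.mul_sum, Finset.sum_boole] at hs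
  rw [Fintype.card_subtype]
  simp at hs
  omega

end Eigenspace

end HeckeFixed

/-- Let `hat` be the Goldman involution (`T_i ↦ (q-q⁻¹) - T_i`) of `H_{R,r}(q)` and
`H¹_{R,r}(q)` its `+1`-eigenspace.  Then `H¹_{R,r}(q)` is a free `R`-module of rank `r!/2`,
i.e. `rank_R H_{R,r}(q) = 2 ⬝ rank_R H¹_{R,r}(q)`. -/
theorem stmt_7 (R : Type*) [CommRing R] [IsDomain R]
    (q qi c h : R) (hq : q * qi = 1) (hc : (q + qi) * c = 1) (h2 : (2 : R) * h = 1)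
    (r : ℕ) (hr : 1 < r)
    (hat : Hecke R q qi (r - 1) ≃ₐ[R] Hecke R q qi (r - 1))
    (hinv : ∀ x, hat (hat x) = x)
    (hhat : ∀ i, hat (Tgen R q qi (r - 1) i) =
      algebraMap R (Hecke R q qi (r - 1)) (q - qi) - Tgen R q qi (r - 1) i) :
    Module.Free R ↥(LinearMap.ker (hat.toLinearMap - LinearMap.id)) ∧
    Module.rank R ↥(LinearMap.ker (hat.toLinearMap - LinearMap.id)) = ((r.factorial / 2 : ℕ) : Cardinal) ∧
    Module.rank R (Hecke R q qi (r - 1)) =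
      2 * Module.rank R ↥(LinearMap.ker (hat.toLinearMap - LinearMap.id)) := by
  obtain ⟨n, rfl⟩ : ∃ n, r = n + 1 + 1 := ⟨r - 2, by omega⟩
  let b : Module.Basis _ R (Hecke R q qi (n + 1)) :=
    Module.Basis.mk (HeckeFixed.linearIndependent_symMonomial hq hc h2 (n + 1))
      (HeckeFixed.span_range_symMonomial hq hc h2 (n + 1)).ge
  let s : Fin (HeckeFixed.normalWords (n + 1)).length → ℕ :=
    fun i => ((HeckeFixed.normalWords (n + 1)).get i).length
  have hb : ∀ i, hat.toLinearMap (b i) = (-1 : R) ^ s i • b i := fun i => by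
    simpa [b, s] using HeckeFixed.map_symMonomial (c := c) hat.toAlgHom hhat i
  have hsum : ∑ i, (-1 : ℤ) ^ s i = 0 := by
    rw [← HeckeFixed.signSum_normalWords n, HeckeFixed.signSum, ← Fin.sum_univ_fun_getElem]
    rfl
  have hcard := HeckeFixed.two_mul_card_even s hsum
  replace hcard := hcard.trans ((Fintype.card_fin _).trans (HeckeFixed.length_normalWords _))
  have hker := HeckeFixed.ker_sub_id_eq_span h2 b hat.toLinearMap s hb
  let b' : Module.Basis {i // Even (s i)} R ↥(LinearMap.ker (hat.toLinearMap - LinearMap.id)) :=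
    (Module.Basis.span (b.linearIndependent.comp _ Subtype.val_injective)).map
      (LinearEquiv.ofEq _ _ hker.symm)
  have hrank : Module.rank R ↥(LinearMap.ker (hat.toLinearMap - LinearMap.id)) =
      (((n + 1 + 1).factorial / 2 : ℕ) : Cardinal) := by
    rw [rank_eq_card_basis b', ← hcard, Nat.mul_div_cancel_left _ two_pos]
  refine ⟨Module.Free.of_basis b', hrank, ?_⟩
  rw [hrank, ← hcard, Nat.mul_div_cancel_left _ two_pos]
  change Module.rank R (Hecke R q qi (n + 1)) = _
  rw [rank_eq_card_basis b,
    (Fintype.card_fin _).trans (HeckeFixed.length_normalWords (n + 1)), ← hcard]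
  push_cast
  rfl
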